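/- arXiv:2206.07954 — 3 statements merged into one kernel-verified Lean document; each statement's English description precedes it below -/
import Mathlib

section
/- Let 0 → N → M → P → 0 be a short exact sequence of finitely generated ℤ-modules (so N is a submodule of M and P = M/N). Let ‖·‖ be a Hilbertian seminorm on M ⊗ ℝ; endow N ⊗ ℝ with the induced (restricted) seminorm (using that N ⊗ ℝ → M ⊗ ℝ is injective) and P ⊗ ℝ = (M ⊗ ℝ)/(N ⊗ ℝ) with the quotient seminorm ‖p‖_q = inf{‖m‖ : m ∈ M ⊗ ℝ maps to p}. Then, as an equality in ℝ ∪ {+∞} (with the convention a + (+∞) = +∞), one has χ̂(M, ‖·‖) = χ̂(N, ‖·‖_restricted) + χ̂(P, ‖·‖_quotient). -/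
open scoped TensorProduct

/-- A function on `M ⊗ ℝ` (realized as `ℝ ⊗[ℤ] M`) is a *Hilbertian seminorm* if it is of the
form `x ↦ √(B x x)` for some positive semidefinite symmetric real bilinear form `B`. -/
def IsHilbertianSeminorm (M : Type*) [AddCommGroup M]
    (nrm : (ℝ ⊗[ℤ] M) → ℝ) : Prop :=
  ∃ B : (ℝ ⊗[ℤ] M) →ₗ[ℝ] (ℝ ⊗[ℤ] M) →ₗ[ℝ] ℝ,
    (∀ x y, B x y = B y x) ∧ (∀ x, 0 ≤ B x x) ∧ (∀ x, nrm x = Real.sqrt (B x x))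

/-- The polarization form of a Hilbertian seminorm on `M ⊗ ℝ`. -/
noncomputable def polarForm (M : Type*) [AddCommGroup M]
    (nrm : (ℝ ⊗[ℤ] M) → ℝ) (x y : ℝ ⊗[ℤ] M) : ℝ :=
  (nrm (x + y) ^ 2 - nrm x ^ 2 - nrm y ^ 2) / 2

/-- `v : Fin n → M` is a basis of `M` modulo its torsion submodule. -/
def IsBasisModTorsion (M : Type*) [AddCommGroup M]
    (n : ℕ) (v : Fin n → M) : Prop :=
  (∀ x : M, ∃ c : Fin n → ℤ, x - ∑ i, c i • v i ∈ Submodule.torsion ℤ M) ∧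
  (∀ c : Fin n → ℤ, (∑ i, c i • v i) ∈ Submodule.torsion ℤ M → c = 0)

/-- The arithmetic degree `χ̂(M, ‖·‖) ∈ ℝ ∪ {+∞}` of a finitely generated `ℤ`-module `M`
equipped with a Hilbertian seminorm `‖·‖` on `M ⊗ ℝ`: it equals `0` if `M = 0`, `+∞` if the
seminorm is not definite, and `- log covol(M, ‖·‖) + log #M_tor` otherwise; here the covolume
is computed as the square root of the Gram determinant of a basis of `M` modulo torsion
(the bilinear form being recovered from the seminorm by polarization). -/
noncomputable def chiHat (M : Type*) [AddCommGroup M]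
    (nrm : (ℝ ⊗[ℤ] M) → ℝ) : EReal := by
  classical
  by_cases hM : Subsingleton M
  · exact 0
  by_cases hdef : ∃ x : ℝ ⊗[ℤ] M, x ≠ 0 ∧ nrm x = 0
  · exact ⊤
  by_cases hb : ∃ (n : ℕ) (v : Fin n → M), IsBasisModTorsion M n v
  · exact
      let n := hb.choose
      let v := hb.choose_spec.choose
      (((- (1 / 2 : ℝ)) * Real.log
          ((Matrix.of fun i j : Fin n =>
            polarForm M nrm ((1 : ℝ) ⊗ₜ[ℤ] v i) ((1 : ℝ) ⊗ₜ[ℤ] v j)).det)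
        + Real.log (Nat.card (Submodule.torsion ℤ M)) : ℝ) : EReal)
  · exact 0

/-- The Gram matrix of a family of vectors with respect to a bilinear form. -/
def gramMatrix {V ι : Type*} [AddCommGroup V] [Module ℝ V] (B : V →ₗ[ℝ] V →ₗ[ℝ] ℝ)
    (x : ι → V) : Matrix ι ι ℝ :=
  Matrix.of fun i j => B (x i) (x j)

theorem gramMatrix_sum_smul {V ι κ : Type*} [AddCommGroup V] [Module ℝ V] [Fintype κ]
    (B : V →ₗ[ℝ] V →ₗ[ℝ] ℝ) (A : Matrix ι κ ℝ) (x : κ → V) :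
    gramMatrix B (fun i => ∑ j, A i j • x j) = A * gramMatrix B x * A.transpose := by
  ext i j
  simp only [gramMatrix, Matrix.of_apply, Matrix.mul_apply, map_sum, map_smul,
    LinearMap.sum_apply, LinearMap.smul_apply, Matrix.transpose_apply, smul_eq_mul,
    Finset.sum_mul, Finset.mul_sum]
  refine Finset.sum_congr rfl fun k _ => Finset.sum_congr rfl fun l _ => by ring

theorem det_gramMatrix_ne_zero {V ι : Type*} [AddCommGroup V] [Module ℝ V] [Fintype ι]
    [DecidableEq ι] (B : V →ₗ[ℝ] V →ₗ[ℝ] ℝ) (hB : ∀ x, B x x = 0 → x = 0) {x : ι → V}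
    (hx : LinearIndependent ℝ x) : (gramMatrix B x).det ≠ 0 := by
  intro h
  obtain ⟨c, hc, h0⟩ := Matrix.exists_mulVec_eq_zero_iff.2 h
  refine hc (funext (Fintype.linearIndependent_iff.1 hx c (hB _ ?_)))
  have hz : ∀ i, B (x i) (∑ j, c j • x j) = 0 := fun i => by
    simpa [gramMatrix, Matrix.mulVec, dotProduct, mul_comm] using congrFun h0 i
  have hl : ∀ y, B (∑ j, c j • x j) y = ∑ j, c j * B (x j) y := fun y => by
    simp [map_sum, LinearMap.sum_apply]
  rw [hl]
  exact Finset.sum_eq_zero fun i _ => by rw [hz i, mul_zero]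

theorem polarForm_eq {M : Type*} [AddCommGroup M] {nrm : (ℝ ⊗[ℤ] M) → ℝ}
    {B : (ℝ ⊗[ℤ] M) →ₗ[ℝ] (ℝ ⊗[ℤ] M) →ₗ[ℝ] ℝ} (hsymm : ∀ x y, B x y = B y x)
    (hnn : ∀ x, 0 ≤ B x x) (hB : ∀ x, nrm x = Real.sqrt (B x x)) (x y : ℝ ⊗[ℤ] M) :
    polarForm M nrm x y = B x y := by
  simp only [polarForm, hB, Real.sq_sqrt (hnn _)]
  simp only [map_add, LinearMap.add_apply, hsymm y x]
  ring

theorem one_tmul_eq_zero_of_mem_torsion {M : Type*} [AddCommGroup M] {x : M}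
    (hx : x ∈ Submodule.torsion ℤ M) : (1 : ℝ) ⊗ₜ[ℤ] x = 0 := by
  obtain ⟨a, ha⟩ := (Submodule.mem_torsion_iff x).1 hx
  have ha0 : ((a : ℤ) : ℝ) ≠ 0 := by exact_mod_cast nonZeroDivisors.coe_ne_zero a
  have h1 : (1 : ℝ) = (a : ℤ) • (((a : ℤ) : ℝ)⁻¹) := by
    rw [zsmul_eq_mul, mul_inv_cancel₀ ha0]
  have ha' : (a : ℤ) • x = 0 := ha
  rw [h1, TensorProduct.smul_tmul, ha', TensorProduct.tmul_zero]

theorem exists_isBasisModTorsion (M : Type*) [AddCommGroup M] [Module.Finite ℤ M] :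
    ∃ (n : ℕ) (v : Fin n → M), IsBasisModTorsion M n v := by
  let b := Module.finBasis ℤ (M ⧸ Submodule.torsion ℤ M)
  choose v hv using fun i => Submodule.mkQ_surjective (Submodule.torsion ℤ M) (b i)
  have key : ∀ c : _ → ℤ, (Submodule.torsion ℤ M).mkQ (∑ i, c i • v i) = ∑ i, c i • b i :=
    fun c => by simp only [map_sum, map_smul, hv]
  refine ⟨_, v, fun x => ⟨b.repr ((Submodule.torsion ℤ M).mkQ x), ?_⟩, fun c hc => ?_⟩
  · rw [← Submodule.Quotient.mk_eq_zero, ← Submodule.mkQ_apply, map_sub, key,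
      b.sum_repr, sub_self]
  · rw [← Submodule.Quotient.mk_eq_zero, ← Submodule.mkQ_apply, key] at hc
    exact funext (Fintype.linearIndependent_iff.1 b.linearIndependent c hc)

theorem IsBasisModTorsion.exists_basis {M : Type*} [AddCommGroup M] {n : ℕ} {v : Fin n → M}
    (hv : IsBasisModTorsion M n v) :
    ∃ b : Module.Basis (Fin n) ℤ (M ⧸ Submodule.torsion ℤ M),
      ∀ i, b i = (Submodule.torsion ℤ M).mkQ (v i) := by
  refine ⟨Module.Basis.mk (v := fun i => (Submodule.torsion ℤ M).mkQ (v i)) ?_ ?_, fun i => by simp⟩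
  · refine Fintype.linearIndependent_iff.2 fun c hc => congrFun (hv.2 c ?_)
    rw [← Submodule.ker_mkQ (Submodule.torsion ℤ M), LinearMap.mem_ker]
    simpa only [map_sum, map_smul] using hc
  · intro y _
    obtain ⟨x, rfl⟩ := Submodule.mkQ_surjective _ y
    obtain ⟨c, hc⟩ := hv.1 x
    rw [← Submodule.ker_mkQ (Submodule.torsion ℤ M), LinearMap.mem_ker, map_sub, sub_eq_zero] at hc
    rw [hc, map_sum]
    exact Submodule.sum_mem _ fun i _ => by
      rw [map_smul]
      exact Submodule.smul_mem _ _ (Submodule.subset_span ⟨i, rfl⟩)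

theorem index_eq_index_comap_mul_index_map {N M P : Type*} [AddCommGroup N] [AddCommGroup M]
    [AddCommGroup P] {f : N →ₗ[ℤ] M} {g : M →ₗ[ℤ] P} (hg : Function.Surjective g)
    (hfg : Function.Exact f g) (L : Submodule ℤ M) :
    L.toAddSubgroup.index =
      (L.comap f).toAddSubgroup.index * (L.map g).toAddSubgroup.index := by
  have h1 : (L.comap f).toAddSubgroup = L.toAddSubgroup.comap f.toAddMonoidHom := rfl
  have h2 : (L.map g).toAddSubgroup = L.toAddSubgroup.map g.toAddMonoidHom := rfl
  have h3 : g.toAddMonoidHom.ker = f.toAddMonoidHom.range := by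
    ext x
    exact hfg x
  have h4 : g.toAddMonoidHom.range = ⊤ := AddMonoidHom.range_eq_top.2 hg
  rw [h1, h2, AddSubgroup.index_comap, AddSubgroup.index_map, h3, h4, AddSubgroup.index_top,
    mul_one, ← AddSubgroup.relIndex_sup_left, AddSubgroup.relIndex_mul_index le_sup_left]

theorem disjoint_span_torsion {M ι : Type*} [AddCommGroup M] {u : ι → M}
    (hu : LinearIndependent ℤ u) :
    Disjoint (Submodule.span ℤ (Set.range u)) (Submodule.torsion ℤ M) := by
  rw [Submodule.disjoint_def]
  intro x hx hxt
  obtain ⟨a, ha⟩ := (Submodule.mem_torsion_iff x).1 hxt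
  obtain ⟨c, rfl⟩ := (Finsupp.mem_span_range_iff_exists_finsupp).1 hx
  have ha' : (a : ℤ) • (Finsupp.linearCombination ℤ u c) = 0 := ha
  rw [← map_smul] at ha'
  have h0 := (linearIndependent_iff.1 hu) _ ha'
  have : c = 0 := (smul_eq_zero.1 h0).resolve_left (nonZeroDivisors.coe_ne_zero a)
  simp [this]

theorem linearIndependent_mkQ_torsion {M ι : Type*} [AddCommGroup M] {u : ι → M}
    (hu : LinearIndependent ℤ u) :
    LinearIndependent ℤ fun i => (Submodule.torsion ℤ M).mkQ (u i) :=
  hu.map (f := (Submodule.torsion ℤ M).mkQ) <| by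
    rw [Submodule.ker_mkQ]
    exact disjoint_span_torsion hu

theorem index_span_eq {M ι : Type*} [AddCommGroup M] [Fintype ι] [DecidableEq ι]
    {u : ι → M} (hu : LinearIndependent ℤ u)
    (b : Module.Basis ι ℤ (M ⧸ Submodule.torsion ℤ M)) :
    (Submodule.span ℤ (Set.range u)).toAddSubgroup.index =
      Nat.card (Submodule.torsion ℤ M) *
        (b.det fun i => (Submodule.torsion ℤ M).mkQ (u i)).natAbs := by
  have hq := linearIndependent_mkQ_torsion hu
  rw [index_eq_index_comap_mul_index_map (f := (Submodule.torsion ℤ M).subtype)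
    (g := (Submodule.torsion ℤ M).mkQ) (Submodule.mkQ_surjective _)
    (LinearMap.exact_subtype_mkQ _)]
  congr 1
  · have : (Submodule.span ℤ (Set.range u)).comap (Submodule.torsion ℤ M).subtype = ⊥ := by
      exact Submodule.disjoint_iff_comap_eq_bot.1 (disjoint_span_torsion hu).symm
    rw [this]
    exact AddSubgroup.index_bot
  · have : (Submodule.span ℤ (Set.range u)).map (Submodule.torsion ℤ M).mkQ =
        Submodule.span ℤ (Set.range fun i => (Submodule.torsion ℤ M).mkQ (u i)) := by
      rw [Submodule.map_span, ← Set.range_comp]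
      rfl
    rw [this, AddSubgroup.index_eq_natAbs_det b _ (Module.Basis.span hq)]
    congr 2
    ext i
    rw [Module.Basis.span_apply hq i]

theorem exists_chiHat_eq {M : Type*} [AddCommGroup M] [Module.Finite ℤ M]
    {nrm : (ℝ ⊗[ℤ] M) → ℝ} {B : (ℝ ⊗[ℤ] M) →ₗ[ℝ] (ℝ ⊗[ℤ] M) →ₗ[ℝ] ℝ}
    (hsymm : ∀ x y, B x y = B y x) (hnn : ∀ x, 0 ≤ B x x)
    (hB : ∀ x, nrm x = Real.sqrt (B x x)) (hdef : ∀ x, B x x = 0 → x = 0)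
    (hM : ¬ Subsingleton M) :
    ∃ (n : ℕ) (v : Fin n → M), IsBasisModTorsion M n v ∧
      chiHat M nrm = ((-(1 / 2 : ℝ) *
        Real.log (gramMatrix B fun i => (1 : ℝ) ⊗ₜ[ℤ] v i).det +
        Real.log (Nat.card (Submodule.torsion ℤ M)) : ℝ) : EReal) := by
  have hb := exists_isBasisModTorsion M
  have hd : ¬ ∃ x : ℝ ⊗[ℤ] M, x ≠ 0 ∧ nrm x = 0 := by
    rintro ⟨x, hx, h0⟩
    rw [hB, Real.sqrt_eq_zero (hnn x)] at h0
    exact hx (hdef x h0)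
  refine ⟨hb.choose, hb.choose_spec.choose, hb.choose_spec.choose_spec, ?_⟩
  unfold chiHat
  rw [dif_neg hM, dif_neg hd, dif_pos hb]
  simp only [polarForm_eq hsymm hnn hB]
  rfl

theorem chiHat_eq_top {M : Type*} [AddCommGroup M] {nrm : (ℝ ⊗[ℤ] M) → ℝ} {x : ℝ ⊗[ℤ] M}
    (hx : x ≠ 0) (h : nrm x = 0) : chiHat M nrm = ⊤ := by
  have hM : ¬ Subsingleton M := fun _ => hx (Subsingleton.elim _ _)
  unfold chiHat
  rw [dif_neg hM, dif_pos ⟨x, hx, h⟩]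

theorem chiHat_ne_bot {M : Type*} [AddCommGroup M] (nrm : (ℝ ⊗[ℤ] M) → ℝ) :
    chiHat M nrm ≠ ⊥ := by
  unfold chiHat
  split_ifs <;> simp [-EReal.coe_add]

theorem finite_torsion (M : Type*) [AddCommGroup M] [Module.Finite ℤ M] :
    Finite (Submodule.torsion ℤ M) :=
  Module.finite_of_fg_torsion _ (Submodule.torsion_isTorsion)

theorem finrank_eq_of_basis_mod_torsion {M ι : Type*} [AddCommGroup M] [Fintype ι]
    (b : Module.Basis ι ℤ (M ⧸ Submodule.torsion ℤ M)) :
    Module.finrank ℤ M = Fintype.card ι := by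
  rw [← finrank_quotient_eq_of_le_torsion (le_refl (Submodule.torsion ℤ M)),
    Module.finrank_eq_card_basis b]

theorem det_ne_zero_of_linearIndependent {M ι : Type*} [AddCommGroup M] [Fintype ι]
    [DecidableEq ι] (b : Module.Basis ι ℤ M) {w : ι → M} (hw : LinearIndependent ℤ w) :
    b.det w ≠ 0 := by
  rw [Module.Basis.det_apply]
  intro h
  obtain ⟨c, hc, h0⟩ := Matrix.exists_mulVec_eq_zero_iff.2 h
  refine hc (funext (Fintype.linearIndependent_iff.1 hw c (b.ext_elem fun i => ?_)))
  have := congrFun h0 i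
  simpa [Matrix.mulVec, dotProduct, Module.Basis.toMatrix_apply, mul_comm] using this

theorem index_span_ne_zero {M ι : Type*} [AddCommGroup M] [Module.Finite ℤ M] [Fintype ι]
    [DecidableEq ι] {u : ι → M} (hu : LinearIndependent ℤ u)
    (hcard : Fintype.card ι = Module.finrank ℤ M) :
    (Submodule.span ℤ (Set.range u)).toAddSubgroup.index ≠ 0 := by
  obtain ⟨n, v, hv⟩ := exists_isBasisModTorsion M
  obtain ⟨b, -⟩ := hv.exists_basis
  have e : ι ≃ Fin n := Fintype.equivOfCardEq (hcard.trans (finrank_eq_of_basis_mod_torsion b))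
  have := finite_torsion M
  rw [index_span_eq hu (b.reindex e.symm)]
  exact mul_ne_zero Nat.card_pos.ne' (Int.natAbs_ne_zero.2
    (det_ne_zero_of_linearIndependent _ (linearIndependent_mkQ_torsion hu)))

/-- The arithmetic degree of a Euclidean lattice can be computed from any maximal linearly
independent family. -/
theorem chiHat_eq_of_linearIndependent {M ι : Type*} [AddCommGroup M] [Module.Finite ℤ M]
    {nrm : (ℝ ⊗[ℤ] M) → ℝ} {B : (ℝ ⊗[ℤ] M) →ₗ[ℝ] (ℝ ⊗[ℤ] M) →ₗ[ℝ] ℝ}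
    (hsymm : ∀ x y, B x y = B y x) (hnn : ∀ x, 0 ≤ B x x)
    (hB : ∀ x, nrm x = Real.sqrt (B x x)) (hdef : ∀ x, B x x = 0 → x = 0)
    [Fintype ι] [DecidableEq ι] {u : ι → M} (hu : LinearIndependent ℤ u)
    (hcard : Fintype.card ι = Module.finrank ℤ M) :
    chiHat M nrm = ((-(1 / 2 : ℝ) *
      Real.log (gramMatrix B fun i => (1 : ℝ) ⊗ₜ[ℤ] u i).det +
      Real.log (Submodule.span ℤ (Set.range u)).toAddSubgroup.index : ℝ) : EReal) := by
  by_cases hM : Subsingleton M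
  · have : IsEmpty ι := Fintype.card_eq_zero_iff.1 (hcard.trans Module.finrank_zero_of_subsingleton)
    have h1 : (Submodule.span ℤ (Set.range u)).toAddSubgroup = ⊤ := Subsingleton.elim _ _
    unfold chiHat
    rw [dif_pos hM, h1]
    simp
  obtain ⟨n, v, hv, h⟩ := exists_chiHat_eq hsymm hnn hB hdef hM
  obtain ⟨b', hb'⟩ := hv.exists_basis
  have e : ι ≃ Fin n := Fintype.equivOfCardEq (hcard.trans (finrank_eq_of_basis_mod_torsion b'))
  set b := b'.reindex e.symm with hbdef
  have hb : ∀ i, b i = (Submodule.torsion ℤ M).mkQ (v (e i)) := fun i => by simp [hbdef, hb']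
  set w : ι → M ⧸ Submodule.torsion ℤ M := fun i => (Submodule.torsion ℤ M).mkQ (u i) with hw
  have hgram : (gramMatrix B fun i => (1 : ℝ) ⊗ₜ[ℤ] v i).det =
      (gramMatrix B fun i => (1 : ℝ) ⊗ₜ[ℤ] v (e i)).det :=
    (Matrix.det_submatrix_equiv_self e _).symm
  let A : Matrix ι ι ℝ := (b.toMatrix w).transpose.map (Int.cast : ℤ → ℝ)
  have hA : A.det = (b.det w : ℤ) := by
    rw [Module.Basis.det_apply, ← Matrix.det_transpose (b.toMatrix w)]
    exact (RingHom.map_det (Int.castRingHom ℝ) _).symm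
  have hdet : b.det w ≠ 0 :=
    det_ne_zero_of_linearIndependent _ (linearIndependent_mkQ_torsion hu)
  have hA0 : A.det ≠ 0 := by rw [hA]; exact_mod_cast hdet
  have hexp : ∀ i, (1 : ℝ) ⊗ₜ[ℤ] u i = ∑ j, A i j • ((1 : ℝ) ⊗ₜ[ℤ] v (e j)) := by
    intro i
    have h1 : u i - ∑ j, b.repr (w i) j • v (e j) ∈ Submodule.torsion ℤ M := by
      rw [← Submodule.Quotient.mk_eq_zero, ← Submodule.mkQ_apply, map_sub, map_sum]
      simp only [map_smul, ← hb, b.sum_repr]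
      exact sub_self _
    have h2 := one_tmul_eq_zero_of_mem_torsion h1
    rw [TensorProduct.tmul_sub, sub_eq_zero, TensorProduct.tmul_sum] at h2
    rw [h2]
    refine Finset.sum_congr rfl fun j _ => ?_
    rw [TensorProduct.tmul_smul]
    exact (Int.cast_smul_eq_zsmul ℝ _ _).symm
  have hvind : LinearIndependent ℝ fun i => (1 : ℝ) ⊗ₜ[ℤ] v (e i) := by
    refine Module.Flat.linearIndependent_one_tmul
      (LinearIndependent.of_comp (Submodule.torsion ℤ M).mkQ ?_)
    have : ((Submodule.torsion ℤ M).mkQ ∘ fun i => v (e i)) = b := funext fun i => (hb i).symm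
    rw [this]
    exact b.linearIndependent
  have hG := det_gramMatrix_ne_zero B hdef hvind
  have := finite_torsion M
  have hT : (Nat.card (Submodule.torsion ℤ M) : ℝ) ≠ 0 := by exact_mod_cast Nat.card_pos.ne'
  rw [h, hgram, funext hexp, gramMatrix_sum_smul, Matrix.det_mul, Matrix.det_mul,
    Matrix.det_transpose, index_span_eq hu b, Real.log_mul (mul_ne_zero hA0 hG) hA0,
    Real.log_mul hA0 hG, Nat.cast_mul, Real.log_mul hT (by exact_mod_cast Int.natAbs_ne_zero.2 hdet),
    hA, Nat.cast_natAbs, Int.cast_abs, Real.log_abs]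
  congr 1
  ring

theorem exists_linearIndependent_card_eq_finrank (M : Type*) [AddCommGroup M]
    [Module.Finite ℤ M] :
    ∃ (n : ℕ) (v : Fin n → M), LinearIndependent ℤ v ∧ n = Module.finrank ℤ M := by
  obtain ⟨n, v, hv⟩ := exists_isBasisModTorsion M
  obtain ⟨b, hb⟩ := hv.exists_basis
  refine ⟨n, v, LinearIndependent.of_comp (Submodule.torsion ℤ M).mkQ ?_, ?_⟩
  · have : ((Submodule.torsion ℤ M).mkQ ∘ v) = b := funext fun i => (hb i).symm
    rw [this]
    exact b.linearIndependent
  · rw [finrank_eq_of_basis_mod_torsion b, Fintype.card_fin]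

theorem IsBasisModTorsion.span_one_tmul_eq_top {M : Type*} [AddCommGroup M] {n : ℕ}
    {v : Fin n → M} (hv : IsBasisModTorsion M n v) :
    Submodule.span ℝ (Set.range fun i => (1 : ℝ) ⊗ₜ[ℤ] v i) = ⊤ := by
  refine eq_top_iff.2 fun x _ => ?_
  induction x using TensorProduct.induction_on with
  | zero => exact Submodule.zero_mem _
  | add x y hx hy => exact Submodule.add_mem _ (hx trivial) (hy trivial)
  | tmul r x =>
    obtain ⟨c, hc⟩ := hv.1 x
    have h := one_tmul_eq_zero_of_mem_torsion hc
    rw [TensorProduct.tmul_sub, sub_eq_zero, TensorProduct.tmul_sum] at h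
    have hr : r ⊗ₜ[ℤ] x = r • ((1 : ℝ) ⊗ₜ[ℤ] x) := by
      rw [TensorProduct.smul_tmul', smul_eq_mul, mul_one]
    rw [hr, h]
    refine Submodule.smul_mem _ _ (Submodule.sum_mem _ fun i _ => ?_)
    rw [TensorProduct.tmul_smul, ← Int.cast_smul_eq_zsmul ℝ]
    exact Submodule.smul_mem _ _ (Submodule.subset_span ⟨i, rfl⟩)

theorem span_one_tmul_eq_top {M ι : Type*} [AddCommGroup M] [Module.Finite ℤ M] [Fintype ι]
    {v : ι → M} (hv : LinearIndependent ℤ v) (hcard : Fintype.card ι = Module.finrank ℤ M) :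
    Submodule.span ℝ (Set.range fun i => (1 : ℝ) ⊗ₜ[ℤ] v i) = ⊤ := by
  have h : LinearIndependent ℝ fun i => (1 : ℝ) ⊗ₜ[ℤ] v i :=
    Module.Flat.linearIndependent_one_tmul hv
  obtain ⟨n, v', hv'⟩ := exists_isBasisModTorsion M
  obtain ⟨b, -⟩ := hv'.exists_basis
  have hc : Module.finrank ℝ (ℝ ⊗[ℤ] M) ≤ Fintype.card ι := by
    rw [hcard, finrank_eq_of_basis_mod_torsion b, ← finrank_top ℝ (ℝ ⊗[ℤ] M),
      ← hv'.span_one_tmul_eq_top]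
    exact finrank_range_le_card _
  exact h.span_eq_top_of_card_eq_finrank' (le_antisymm h.fintype_card_le_finrank hc)

section ShortExact

variable {N M P : Type*} [AddCommGroup N] [AddCommGroup M] [AddCommGroup P]
  {f : N →ₗ[ℤ] M} {g : M →ₗ[ℤ] P}

theorem finrank_eq_add_of_exact [Module.Finite ℤ M] (hf : Function.Injective f)
    (hg : Function.Surjective g) (hfg : Function.Exact f g) :
    Module.finrank ℤ M = Module.finrank ℤ N + Module.finrank ℤ P := by
  have h := Submodule.finrank_quotient_add_finrank (LinearMap.ker g)
  rw [(g.quotKerEquivOfSurjective hg).finrank_eq, LinearMap.exact_iff.1 hfg,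
    LinearMap.finrank_range_of_inj hf, add_comm] at h
  exact h.symm

variable {ι κ : Type*} {v : ι → N} {w : κ → M}

theorem map_span_sumElim (hfg : Function.Exact f g) :
    (Submodule.span ℤ (Set.range (Sum.elim (f ∘ v) w))).map g =
      Submodule.span ℤ (Set.range fun j => g (w j)) := by
  have h : (Submodule.span ℤ (Set.range (f ∘ v))).map g = ⊥ := by
    rw [Submodule.map_span, Submodule.span_eq_bot]
    rintro _ ⟨_, ⟨i, rfl⟩, rfl⟩
    exact hfg.apply_apply_eq_zero _
  rw [Set.Sum.elim_range, Submodule.span_union, Submodule.map_sup, h, bot_sup_eq,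
    Submodule.map_span, ← Set.range_comp]
  rfl

variable [Fintype ι] [Fintype κ]

theorem map_sum_smul_sumElim (hfg : Function.Exact f g) (c : ι ⊕ κ → ℤ) :
    g (∑ i, c i • Sum.elim (f ∘ v) w i) = ∑ j, c (Sum.inr j) • g (w j) := by
  simp [Fintype.sum_sum_type, hfg.apply_apply_eq_zero]

theorem linearIndependent_sumElim_of_exact (hf : Function.Injective f)
    (hfg : Function.Exact f g) (hv : LinearIndependent ℤ v)
    (hw : LinearIndependent ℤ fun j => g (w j)) :
    LinearIndependent ℤ (Sum.elim (f ∘ v) w) := by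
  refine Fintype.linearIndependent_iff.2 fun c hc => ?_
  have h1 := map_sum_smul_sumElim (v := v) (w := w) hfg c
  rw [hc, map_zero] at h1
  have h2 := Fintype.linearIndependent_iff.1 hw _ h1.symm
  have h3 : f (∑ i, c (Sum.inl i) • v i) = 0 := by
    simpa [Fintype.sum_sum_type, h2] using hc
  have h4 := Fintype.linearIndependent_iff.1 hv _ ((map_eq_zero_iff f hf).1 h3)
  rintro (i | j)
  exacts [h4 i, h2 j]

theorem comap_span_sumElim (hf : Function.Injective f)
    (hfg : Function.Exact f g) (hw : LinearIndependent ℤ fun j => g (w j)) :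
    (Submodule.span ℤ (Set.range (Sum.elim (f ∘ v) w))).comap f =
      Submodule.span ℤ (Set.range v) := by
  refine le_antisymm (fun x hx => ?_) (Submodule.span_le.2 ?_)
  · obtain ⟨c, hc⟩ := (Submodule.mem_span_range_iff_exists_fun ℤ).1 (Submodule.mem_comap.1 hx)
    have h1 := map_sum_smul_sumElim (v := v) (w := w) hfg c
    rw [hc, hfg.apply_apply_eq_zero] at h1
    have h2 := Fintype.linearIndependent_iff.1 hw _ h1.symm
    refine (Submodule.mem_span_range_iff_exists_fun ℤ).2 ⟨fun i => c (Sum.inl i), hf ?_⟩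
    simpa [Fintype.sum_sum_type, h2] using hc
  · rintro _ ⟨i, rfl⟩
    exact Submodule.subset_span ⟨Sum.inl i, rfl⟩

/-- A surjection with kernel the range of `F` has a section orthogonal to the range of `F`. -/
theorem exists_orthogonal_section {U V W : Type*} [AddCommGroup U] [Module ℝ U] [AddCommGroup V]
    [Module ℝ V] [FiniteDimensional ℝ V] [AddCommGroup W] [Module ℝ W]
    {F : U →ₗ[ℝ] V} {G : V →ₗ[ℝ] W} (hG : Function.Surjective G) (hFG : Function.Exact F G)
    {B : V →ₗ[ℝ] V →ₗ[ℝ] ℝ} (hsymm : ∀ x y, B x y = B y x) (hdef : ∀ x, B x x = 0 → x = 0) :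
    ∃ S : W →ₗ[ℝ] V, (∀ p, G (S p) = p) ∧ ∀ x p, B (F x) (S p) = 0 := by
  have hrefl : LinearMap.BilinForm.IsRefl B := fun x y h => by rw [hsymm, h]
  have hc : IsCompl (LinearMap.range F) (LinearMap.BilinForm.orthogonal B (LinearMap.range F)) := by
    rw [LinearMap.BilinForm.isCompl_orthogonal_iff_disjoint hrefl, Submodule.disjoint_def]
    exact fun x hx hx' => hdef x (hx' x hx)
  obtain ⟨T, hT⟩ := G.exists_rightInverse_of_surjective (LinearMap.range_eq_top.2 hG)
  have hT' : ∀ p, G (T p) = p := fun p => LinearMap.congr_fun hT p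
  let π := (LinearMap.BilinForm.orthogonal B (LinearMap.range F)).projection _ hc.symm
  have hπ : ∀ x, x - π x ∈ LinearMap.range F :=
    Submodule.sub_projection_mem hc.symm
  refine ⟨π ∘ₗ T, fun p => ?_, fun x p => ?_⟩
  · obtain ⟨y, hy⟩ := hπ (T p)
    have := hFG.apply_apply_eq_zero y
    rw [hy, map_sub, hT', sub_eq_zero] at this
    exact this.symm
  · have : π (T p) ∈ LinearMap.BilinForm.orthogonal B (LinearMap.range F) :=
      Submodule.projection_apply_mem hc.symm _
    exact this _ ⟨x, rfl⟩

/-- The infimum of a Hilbertian seminorm over a fibre is attained at an orthogonal section. -/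
theorem sInf_fibre_eq {U V W : Type*} [AddCommGroup U] [Module ℝ U] [AddCommGroup V]
    [Module ℝ V] [AddCommGroup W] [Module ℝ W]
    {F : U →ₗ[ℝ] V} {G : V →ₗ[ℝ] W} (hFG : Function.Exact F G)
    {B : V →ₗ[ℝ] V →ₗ[ℝ] ℝ} (hsymm : ∀ x y, B x y = B y x) (hnn : ∀ x, 0 ≤ B x x)
    {nrm : V → ℝ} (hB : ∀ x, nrm x = Real.sqrt (B x x))
    {S : W →ₗ[ℝ] V} (hS : ∀ p, G (S p) = p) (hFS : ∀ x p, B (F x) (S p) = 0) (p : W) :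
    sInf (nrm '' (G ⁻¹' {p})) = Real.sqrt (B (S p) (S p)) := by
  refine IsLeast.csInf_eq ⟨⟨S p, hS p, hB _⟩, ?_⟩
  rintro _ ⟨m, hm, rfl⟩
  rw [hB]
  obtain ⟨x, hx⟩ := (hFG (m - S p)).1 (by rw [map_sub, hS, hm, sub_self])
  have hm' : m = F x + S p := by rw [hx, sub_add_cancel]
  refine Real.sqrt_le_sqrt ?_
  have := hnn (F x)
  rw [hm']
  simp only [map_add, LinearMap.add_apply, hFS, hsymm (S p) (F x)]
  linarith

theorem det_gramMatrix_sumElim [DecidableEq ι] [DecidableEq κ] {U V W : Type*} [AddCommGroup U]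
    [Module ℝ U] [AddCommGroup V] [Module ℝ V] [AddCommGroup W] [Module ℝ W]
    {F : U →ₗ[ℝ] V} {G : V →ₗ[ℝ] W} (hFG : Function.Exact F G)
    {B : V →ₗ[ℝ] V →ₗ[ℝ] ℝ} (hsymm : ∀ x y, B x y = B y x)
    {S : W →ₗ[ℝ] V} (hS : ∀ p, G (S p) = p) (hFS : ∀ x p, B (F x) (S p) = 0)
    {x : ι → U} (hx : Submodule.span ℝ (Set.range x) = ⊤) (y : κ → V) :
    (gramMatrix B (Sum.elim (F ∘ x) y)).det =
      (gramMatrix (B.compl₁₂ F F) x).det *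
        (gramMatrix (B.compl₁₂ S S) fun j => G (y j)).det := by
  have hex : ∀ j, ∃ c : ι → ℝ, y j = ∑ i, c i • F (x i) + S (G (y j)) := by
    intro j
    obtain ⟨z, hz⟩ := (hFG (y j - S (G (y j)))).1 (by rw [map_sub, hS, sub_self])
    obtain ⟨c, hc⟩ := (Submodule.mem_span_range_iff_exists_fun ℝ).1
      (hx ▸ Submodule.mem_top : z ∈ Submodule.span ℝ (Set.range x))
    refine ⟨c, ?_⟩
    rw [← sub_eq_iff_eq_add, ← hz, ← hc, map_sum]
    simp only [map_smul]
  choose C hC using hex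
  let A : Matrix (ι ⊕ κ) (ι ⊕ κ) ℝ := Matrix.fromBlocks 1 0 (Matrix.of C) 1
  have hA : A.det = 1 := by simp [A]
  have h1 : Sum.elim (F ∘ x) y =
      fun i => ∑ j, A i j • Sum.elim (F ∘ x) (fun j => S (G (y j))) j := by
    funext i
    rcases i with i | j
    · simp [A, Fintype.sum_sum_type, Matrix.one_apply]
    · simp [A, Fintype.sum_sum_type, Matrix.one_apply, ← hC j]
  have h2 : gramMatrix B (Sum.elim (F ∘ x) (fun j => S (G (y j)))) =
      Matrix.fromBlocks (gramMatrix (B.compl₁₂ F F) x) 0 0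
        (gramMatrix (B.compl₁₂ S S) fun j => G (y j)) := by
    ext (i | i) (j | j) <;> simp [gramMatrix, hFS, hsymm (S _) (F _)]
  rw [h1, gramMatrix_sum_smul, Matrix.det_mul, Matrix.det_mul, Matrix.det_transpose, hA, h2,
    Matrix.det_fromBlocks_zero₂₁]
  ring

theorem chiHat_eq_add_of_exact [Module.Finite ℤ N] [Module.Finite ℤ M] [Module.Finite ℤ P]
    (hf : Function.Injective f) (hg : Function.Surjective g) (hfg : Function.Exact f g)
    {nrm : (ℝ ⊗[ℤ] M) → ℝ} (hnrm : IsHilbertianSeminorm M nrm) :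
    chiHat M nrm = chiHat N (fun x => nrm (f.lTensor ℝ x)) +
      chiHat P (fun p => sInf (nrm '' (g.lTensor ℝ ⁻¹' {p}))) := by
  obtain ⟨B, hsymm, hnn, hB⟩ := hnrm
  have hFinj : Function.Injective (f.lTensor ℝ) :=
    Module.Flat.lTensor_preserves_injective_linearMap f hf
  have hFG : Function.Exact (f.lTensor ℝ) (g.lTensor ℝ) := lTensor_exact ℝ hfg hg
  have hG : Function.Surjective (g.lTensor ℝ) := LinearMap.lTensor_surjective ℝ hg
  by_cases hdef : ∀ x, B x x = 0 → x = 0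
  · obtain ⟨S, hS, hFS⟩ := exists_orthogonal_section (F := f.baseChange ℝ) (G := g.baseChange ℝ)
      hG hFG hsymm hdef
    obtain ⟨a, v, hv, ha⟩ := exists_linearIndependent_card_eq_finrank N
    obtain ⟨b, w, hw, hb⟩ := exists_linearIndependent_card_eq_finrank P
    choose w' hw' using fun j => hg (w j)
    obtain rfl : (fun j => g (w' j)) = w := funext hw'
    have hcard : Fintype.card (Fin a ⊕ Fin b) = Module.finrank ℤ M := by
      simp [finrank_eq_add_of_exact hf hg hfg, ha, hb]
    have ha' : Fintype.card (Fin a) = Module.finrank ℤ N := by simp [ha]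
    have hb' : Fintype.card (Fin b) = Module.finrank ℤ P := by simp [hb]
    have hu := linearIndependent_sumElim_of_exact hf hfg hv hw
    have hx : Submodule.span ℝ (Set.range fun i => (1 : ℝ) ⊗ₜ[ℤ] v i) = ⊤ :=
      span_one_tmul_eq_top hv ha'
    have hSinj : ∀ p, S p = 0 → p = 0 := fun p hp => by rw [← hS p, hp, map_zero]
    have hdefN : ∀ x, B.compl₁₂ (f.baseChange ℝ) (f.baseChange ℝ) x x = 0 → x = 0 := fun x hx =>
      (map_eq_zero_iff (f.baseChange ℝ) hFinj).1 (hdef _ hx)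
    have hdefP : ∀ p, B.compl₁₂ S S p p = 0 → p = 0 := fun p hp => hSinj p (hdef _ hp)
    have h1 := chiHat_eq_of_linearIndependent hsymm hnn hB hdef hu hcard
    have h2 := chiHat_eq_of_linearIndependent (nrm := fun x => nrm (f.lTensor ℝ x))
      (B := B.compl₁₂ (f.baseChange ℝ) (f.baseChange ℝ))
      (fun _ _ => hsymm _ _) (fun _ => hnn _) (fun _ => hB _) hdefN hv ha'
    have h3 := chiHat_eq_of_linearIndependent
      (nrm := fun p => sInf (nrm '' (g.lTensor ℝ ⁻¹' {p}))) (B := B.compl₁₂ S S)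
      (fun _ _ => hsymm _ _) (fun _ => hnn _)
      (fun p => sInf_fibre_eq (F := f.baseChange ℝ) (G := g.baseChange ℝ)
        hFG hsymm hnn hB hS hFS p) hdefP hw hb'
    have hgram := det_gramMatrix_sumElim (F := f.baseChange ℝ) (G := g.baseChange ℝ) hFG hsymm
      hS hFS hx (fun j => (1 : ℝ) ⊗ₜ[ℤ] w' j)
    have helim : (fun i => (1 : ℝ) ⊗ₜ[ℤ] Sum.elim (f ∘ v) w' i) =
        Sum.elim (f.baseChange ℝ ∘ fun i => (1 : ℝ) ⊗ₜ[ℤ] v i)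
          (fun j => (1 : ℝ) ⊗ₜ[ℤ] w' j) := by
      funext i
      rcases i with i | j <;> simp
    simp only [LinearMap.baseChange_tmul] at hgram
    have hN0 := det_gramMatrix_ne_zero _ hdefN (Module.Flat.linearIndependent_one_tmul hv)
    have hP0 := det_gramMatrix_ne_zero _ hdefP (Module.Flat.linearIndependent_one_tmul hw)
    rw [h1, h2, h3, helim, hgram, index_eq_index_comap_mul_index_map hg hfg,
      comap_span_sumElim hf hfg hw, map_span_sumElim hfg, ← EReal.coe_add, Nat.cast_mul,
      Real.log_mul hN0 hP0, Real.log_mul (by exact_mod_cast index_span_ne_zero hv ha')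
        (by exact_mod_cast index_span_ne_zero hw hb')]
    congr 1
    ring
  · push Not at hdef
    obtain ⟨x, hx0, hx⟩ := hdef
    have hnx : nrm x = 0 := by rw [hB, hx0, Real.sqrt_zero]
    rw [chiHat_eq_top hx hnx]
    by_cases hgx : g.lTensor ℝ x = 0
    · obtain ⟨y, rfl⟩ := (hFG x).1 hgx
      rw [chiHat_eq_top (x := y) (by rintro rfl; simp at hx) hnx,
        EReal.top_add_of_ne_bot (chiHat_ne_bot _)]
    · rw [chiHat_eq_top hgx, EReal.add_top_of_ne_bot (chiHat_ne_bot _)]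
      have h0 : ∀ y, 0 ≤ nrm y := fun y => by rw [hB]; exact Real.sqrt_nonneg _
      refine IsLeast.csInf_eq ⟨⟨x, rfl, hnx⟩, ?_⟩
      rintro _ ⟨y, -, rfl⟩
      exact h0 y

end ShortExact

/-- **Additivity of the arithmetic degree in short exact sequences.**
Let `0 → N → M → P → 0` be a short exact sequence of finitely generated `ℤ`-modules (`N` a
submodule of `M`, `P = M ⧸ N`), and let `‖·‖` be a Hilbertian seminorm on `M ⊗ ℝ`. Endowing
`N ⊗ ℝ` with the restricted seminorm (via the injective map `N ⊗ ℝ → M ⊗ ℝ`) and `P ⊗ ℝ` with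
the quotient seminorm `‖p‖ = inf {‖m‖ : m ∈ M ⊗ ℝ, m ↦ p}`, one has
`χ̂(M, ‖·‖) = χ̂(N, ‖·‖_res) + χ̂(P, ‖·‖_quot)` in `ℝ ∪ {+∞}`. -/
theorem chiHat_eq_add_of_shortExact (M : Type*) [AddCommGroup M]
    [Module.Finite ℤ M] (N : Submodule ℤ M)
    (nrm : (ℝ ⊗[ℤ] M) → ℝ) (hnrm : IsHilbertianSeminorm M nrm) :
    chiHat M nrm
      = chiHat (↥N)
          (fun x => nrm (LinearMap.lTensor ℝ N.subtype.toAddMonoidHom.toIntLinearMap x))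
        + chiHat (M ⧸ N)
          (fun p => sInf (nrm ''
            (LinearMap.lTensor ℝ N.mkQ.toAddMonoidHom.toIntLinearMap ⁻¹' {p}))) := by
  have : Module.Finite ℤ N := inferInstance
  exact chiHat_eq_add_of_exact (f := N.subtype.toAddMonoidHom.toIntLinearMap)
    (g := N.mkQ.toAddMonoidHom.toIntLinearMap) N.injective_subtype N.mkQ_surjective
    (LinearMap.exact_subtype_mkQ N) hnrm
end

section
/- Let M be a finitely generated ℤ-module whose free part has rank r = dim_ℝ(M ⊗ ℝ). Let ‖·‖ and ‖·‖′ be two Hilbertian seminorms on M ⊗ ℝ, and let C > 0 be a real number such that ‖x‖ ≥ C·‖x‖′ for all x ∈ M ⊗ ℝ. Then, as an inequality in ℝ ∪ {+∞}, χ̂(M, ‖·‖) ≤ χ̂(M, ‖·‖′) − r·log C. In particular (taking C = 1), χ̂ is monotone decreasing in the seminorm: ‖·‖ ≥ ‖·‖′ implies χ̂(M, ‖·‖) ≤ χ̂(M, ‖·‖′). -/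
open scoped TensorProduct

namespace Matrix

variable {n : Type*} [Fintype n] [DecidableEq n]

/-- If `P` is positive semidefinite, then `1 ≤ det (1 + P)`. -/
theorem PosSemidef.one_le_det_one_add {P : Matrix n n ℝ} (hP : P.PosSemidef) :
    1 ≤ (1 + P).det := by
  have h1 : (1 + P).PosSemidef := PosSemidef.one.add hP
  rw [h1.isHermitian.det_eq_prod_eigenvalues]
  refine Finset.one_le_prod fun i _ ↦ ?_
  have hv := h1.isHermitian.eigenvalues_eq i
  set v := h1.isHermitian.eigenvectorBasis i with hvdef
  have hnorm : (v.ofLp) ⬝ᵥ v.ofLp = 1 := by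
    have h := h1.isHermitian.eigenvectorBasis.orthonormal.1 i
    rw [← hvdef, EuclideanSpace.norm_eq, Real.sqrt_eq_one] at h
    simpa [dotProduct, sq] using h
  have hnn := hP.dotProduct_mulVec_nonneg v.ofLp
  rw [add_mulVec, one_mulVec, dotProduct_add] at hv
  simp only [star_trivial, RCLike.re_to_real] at hv hnn
  change 1 ≤ h1.isHermitian.eigenvalues i
  rw [hv, hnorm]
  exact le_add_of_nonneg_right hnn

/-- The determinant is monotone on positive definite real matrices for the Loewner order. -/
theorem PosDef.det_le_det {A B : Matrix n n ℝ} (hA : A.PosDef) (hAB : (B - A).PosSemidef) :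
    A.det ≤ B.det := by
  open scoped MatrixOrder in
  obtain ⟨S, hS⟩ := CStarAlgebra.nonneg_iff_eq_star_mul_self.mp hA.posSemidef.nonneg
  have hdet : IsUnit S.det := by
    have h := hA.det_pos.ne'
    rw [hS, det_mul] at h
    exact isUnit_iff_ne_zero.mpr (right_ne_zero_of_mul h)
  rw [star_eq_conjTranspose] at hS
  have hQ := hAB.conjTranspose_mul_mul_same S⁻¹
  have hB : B = Sᴴ * (1 + S⁻¹ᴴ * (B - A) * S⁻¹) * S := by
    have h1 : Sᴴ * S⁻¹ᴴ = 1 := by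
      rw [← conjTranspose_mul, nonsing_inv_mul _ hdet, conjTranspose_one]
    have h2 : S⁻¹ * S = 1 := nonsing_inv_mul _ hdet
    calc B = A + 1 * (B - A) * 1 := by simp
      _ = Sᴴ * S + (Sᴴ * S⁻¹ᴴ) * (B - A) * (S⁻¹ * S) := by rw [h1, h2, ← hS]
      _ = _ := by simp only [mul_add, add_mul, Matrix.mul_assoc, mul_one]
  have hBdet : B.det = A.det * (1 + S⁻¹ᴴ * (B - A) * S⁻¹).det := by
    conv_lhs => rw [hB]
    rw [det_mul, det_mul, hS, det_mul]
    ring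
  rw [hBdet]
  exact le_mul_of_one_le_right hA.det_pos.le hQ.one_le_det_one_add

end Matrix

namespace IsBasisModTorsion

variable {M : Type*} [AddCommGroup M] {n : ℕ} {v : Fin n → M}

theorem linearIndependent (h : IsBasisModTorsion M n v) : LinearIndependent ℤ v :=
  Fintype.linearIndependent_iff.mpr fun c hc ↦
    congrFun (h.2 c (hc ▸ Submodule.zero_mem _))

theorem top_le_span (h : IsBasisModTorsion M n v) :
    ⊤ ≤ Submodule.span ℝ (Set.range fun i ↦ (1 : ℝ) ⊗ₜ[ℤ] v i) := by
  rintro x -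
  induction x with
  | zero => exact Submodule.zero_mem _
  | add x y hx hy => exact Submodule.add_mem _ hx hy
  | tmul r m =>
    obtain ⟨c, hc⟩ := h.1 m
    have h0 := one_tmul_eq_zero_of_mem_torsion hc
    rw [TensorProduct.tmul_sub, sub_eq_zero, TensorProduct.tmul_sum] at h0
    rw [← mul_one r, ← smul_eq_mul, ← TensorProduct.smul_tmul', h0]
    refine Submodule.smul_mem _ _ (Submodule.sum_mem _ fun i _ ↦ ?_)
    rw [TensorProduct.tmul_smul]
    exact zsmul_mem (Submodule.subset_span (Set.mem_range_self i)) _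

/-- The basis of `M ⊗ ℝ` induced by a basis of `M` modulo torsion. -/
noncomputable def tensorBasis (h : IsBasisModTorsion M n v) :
    Module.Basis (Fin n) ℝ (ℝ ⊗[ℤ] M) :=
  Module.Basis.mk (Module.Flat.linearIndependent_one_tmul (S := ℝ) h.linearIndependent)
    h.top_le_span

@[simp]
theorem tensorBasis_apply (h : IsBasisModTorsion M n v) (i : Fin n) :
    h.tensorBasis i = (1 : ℝ) ⊗ₜ[ℤ] v i :=
  Module.Basis.mk_apply _ _ i

theorem eq_finrank (h : IsBasisModTorsion M n v) : n = Module.finrank ℝ (ℝ ⊗[ℤ] M) := by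
  simp [Module.finrank_eq_card_basis h.tensorBasis]

end IsBasisModTorsion

namespace IsHilbertianSeminorm

variable {M : Type*} [AddCommGroup M] {nrm : (ℝ ⊗[ℤ] M) → ℝ} {n : ℕ}

theorem nonneg (h : IsHilbertianSeminorm M nrm) (x : ℝ ⊗[ℤ] M) : 0 ≤ nrm x := by
  obtain ⟨B, -, -, hB⟩ := h
  exact hB x ▸ Real.sqrt_nonneg _

/-- The Gram matrix of a polar form is Hermitian. -/
theorem gram_isHermitian (e : Fin n → ℝ ⊗[ℤ] M) :
    (Matrix.of fun i j ↦ polarForm M nrm (e i) (e j)).IsHermitian := by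
  ext i j
  simp only [Matrix.conjTranspose_apply, Matrix.of_apply, star_trivial, polarForm, add_comm (e j)]
  ring

/-- The quadratic form of the Gram matrix of a Hilbertian seminorm is the squared seminorm. -/
theorem dotProduct_gram_mulVec (h : IsHilbertianSeminorm M nrm) (e : Fin n → ℝ ⊗[ℤ] M)
    (c : Fin n → ℝ) :
    c ⬝ᵥ ((Matrix.of fun i j ↦ polarForm M nrm (e i) (e j)).mulVec c) =
      nrm (∑ i, c i • e i) ^ 2 := by
  obtain ⟨B, hsymm, hpos, hB⟩ := h
  have hsq (x) : nrm x ^ 2 = B x x := by rw [hB, Real.sq_sqrt (hpos x)]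
  have hpol (x y) : polarForm M nrm x y = B x y := by
    simp only [polarForm, hsq, map_add, LinearMap.add_apply, hsymm y x]
    ring
  simp only [hsq, hpol, map_sum, LinearMap.sum_apply, map_smul, LinearMap.smul_apply, smul_eq_mul,
    dotProduct, Matrix.mulVec, Matrix.of_apply, Finset.mul_sum]
  rw [Finset.sum_comm]
  refine Finset.sum_congr rfl fun i _ ↦ Finset.sum_congr rfl fun j _ ↦ ?_
  ring

end IsHilbertianSeminorm

/-- Comparison of Gram determinants of two Hilbertian seminorms, the smaller one definite. -/
theorem pow_mul_det_gram_le {M : Type*} [AddCommGroup M] {nrm nrm' : (ℝ ⊗[ℤ] M) → ℝ}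
    (hnrm : IsHilbertianSeminorm M nrm) (hnrm' : IsHilbertianSeminorm M nrm')
    (hdef : ∀ x, nrm' x = 0 → x = 0) {C : ℝ} (hC : 0 < C) (hle : ∀ x, C * nrm' x ≤ nrm x)
    {n : ℕ} {e : Fin n → ℝ ⊗[ℤ] M} (he : LinearIndependent ℝ e) :
    0 < (Matrix.of fun i j ↦ polarForm M nrm' (e i) (e j)).det ∧
    (C ^ 2) ^ n * (Matrix.of fun i j ↦ polarForm M nrm' (e i) (e j)).det ≤
      (Matrix.of fun i j ↦ polarForm M nrm (e i) (e j)).det := by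
  set G := Matrix.of fun i j ↦ polarForm M nrm (e i) (e j) with hG
  set G' := Matrix.of fun i j ↦ polarForm M nrm' (e i) (e j) with hG'
  have hGherm : G.IsHermitian := IsHilbertianSeminorm.gram_isHermitian e
  have hGherm' : G'.IsHermitian := IsHilbertianSeminorm.gram_isHermitian e
  have hpd : G'.PosDef := by
    refine .of_dotProduct_mulVec_pos hGherm' fun {c} hc ↦ ?_
    rw [star_trivial, hnrm'.dotProduct_gram_mulVec]
    refine pow_pos ((hnrm'.nonneg _).lt_of_ne' fun h0 ↦ hc ?_) 2
    exact funext (Fintype.linearIndependent_iff.mp he c (hdef _ h0))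
  have hpsd : (G - C ^ 2 • G').PosSemidef := by
    refine .of_dotProduct_mulVec_nonneg
      (hGherm.sub (hGherm'.smul (IsSelfAdjoint.all (C ^ 2)))) fun c ↦ ?_
    rw [star_trivial, Matrix.sub_mulVec, Matrix.smul_mulVec, dotProduct_sub, dotProduct_smul,
      hnrm.dotProduct_gram_mulVec, hnrm'.dotProduct_gram_mulVec, smul_eq_mul, ← mul_pow,
      sub_nonneg]
    exact pow_le_pow_left₀ (mul_nonneg hC.le (hnrm'.nonneg _)) (hle _) 2
  refine ⟨hpd.det_pos, ?_⟩
  simpa using (hpd.smul (pow_pos hC 2)).det_le_det hpsd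

/-- **Monotonicity of the arithmetic degree with a scaling factor.**
Let `M` be a finitely generated `ℤ`-module whose free part has rank
`r = dim_ℝ (M ⊗ ℝ)`, and let `‖·‖`, `‖·‖′` be two Hilbertian seminorms on `M ⊗ ℝ` such that
`‖x‖ ≥ C·‖x‖′` for all `x`, for some real `C > 0`. Then, in `ℝ ∪ {+∞}`,
`χ̂(M, ‖·‖) ≤ χ̂(M, ‖·‖′) − r·log C`. -/
theorem chiHat_le_sub_of_le (M : Type*) [AddCommGroup M] [Module.Finite ℤ M]
    (r : ℕ) (hr : r = Module.finrank ℝ (ℝ ⊗[ℤ] M))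
    (nrm nrm' : (ℝ ⊗[ℤ] M) → ℝ)
    (hnrm : IsHilbertianSeminorm M nrm) (hnrm' : IsHilbertianSeminorm M nrm')
    (C : ℝ) (hC : 0 < C) (hle : ∀ x, C * nrm' x ≤ nrm x) :
    chiHat M nrm ≤ chiHat M nrm' - (((r : ℝ) * Real.log C : ℝ) : EReal) := by
  have hdef_of (x : ℝ ⊗[ℤ] M) (hx : nrm x = 0) : nrm' x = 0 :=
    le_antisymm (nonpos_of_mul_nonpos_right (hx ▸ hle x) hC) (hnrm'.nonneg x)
  by_cases hM : Subsingleton M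
  · have : Subsingleton (ℝ ⊗[ℤ] M) := by
      refine ⟨fun x y ↦ ?_⟩
      have h (z : ℝ ⊗[ℤ] M) : z = 0 := by
        induction z with
        | zero => rfl
        | add x y hx hy => rw [hx, hy, add_zero]
        | tmul r m => rw [Subsingleton.elim m 0, TensorProduct.tmul_zero]
      rw [h x, h y]
    have hr0 : r = 0 := hr.trans Module.finrank_zero_of_subsingleton
    simp [chiHat, hM, hr0]
  by_cases hd' : ∃ x : ℝ ⊗[ℤ] M, x ≠ 0 ∧ nrm' x = 0
  · have htop : chiHat M nrm' = ⊤ := by simp only [chiHat, dif_neg hM, dif_pos hd']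
    rw [htop, EReal.top_sub_coe]
    exact le_top
  have hd : ¬ ∃ x : ℝ ⊗[ℤ] M, x ≠ 0 ∧ nrm x = 0 :=
    fun ⟨x, hx, hx0⟩ ↦ hd' ⟨x, hx, hdef_of x hx0⟩
  have hb := exists_isBasisModTorsion M
  simp only [chiHat, dif_neg hM, dif_neg hd, dif_neg hd', dif_pos hb]
  have hv := hb.choose_spec.choose_spec
  generalize hb.choose_spec.choose = v at hv ⊢
  generalize hb.choose = n at v hv ⊢
  have hn : n = r := hv.eq_finrank.trans hr.symm
  obtain ⟨hpos, hdet⟩ := pow_mul_det_gram_le hnrm hnrm'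
    (fun x hx ↦ by_contra fun h ↦ hd' ⟨x, h, hx⟩) hC hle
    (Module.Flat.linearIndependent_one_tmul (S := ℝ) hv.linearIndependent)
  have hlog := Real.log_le_log (mul_pos (pow_pos (pow_pos hC 2) n) hpos) hdet
  rw [Real.log_mul (pow_pos (pow_pos hC 2) n).ne' hpos.ne', Real.log_pow, Real.log_pow] at hlog
  subst hn
  rw [← EReal.coe_sub, EReal.coe_le_coe_iff]
  push_cast at hlog
  linarith
end

section
/- Let N ∈ ℕ and let ε be a real number with 0 < ε ≤ 1/√(2(N+1)). Then for every finitely supported family (b_n)_{n ∈ ℕ^{N+1}} of nonnegative real numbers, Σ_{n ∈ ℕ^{N+1}} b_n² ≥ (1/2)·(Σ_{n ∈ ℕ^{N+1}} b_n · ε^{|n|})², where |n| denotes the sum of the coordinates of the multi-index n ∈ ℕ^{N+1}. -/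
/-- A partial sum of the multivariate geometric series is at most `2` when `|ι| * x ≤ 1 / 2`. -/
theorem sum_pow_sum_le_two {ι : Type*} [Fintype ι] [Nonempty ι] {x : ℝ} (hx : 0 ≤ x)
    (hx' : Fintype.card ι * x ≤ 1 / 2) (s : Finset (ι → ℕ)) :
    ∑ n ∈ s, x ^ (∑ k, n k) ≤ 2 := by
  classical
  have hcard : (1 : ℝ) ≤ Fintype.card ι := by exact_mod_cast Fintype.card_pos (α := ι)
  have hx1 : x ≤ 1 / 2 := by nlinarith
  have hpos : 0 < 1 - x := by linarith
  let K := s.sup (fun n => ∑ k, n k) + 1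
  have hsub : s ⊆ Fintype.piFinset fun _ => Finset.range K := fun n hn => by
    simp only [Fintype.mem_piFinset, Finset.mem_range]
    intro k
    exact Nat.lt_succ_of_le ((Finset.single_le_sum (f := n) (fun _ _ => Nat.zero_le _)
      (Finset.mem_univ k)).trans (Finset.le_sup (f := fun n : ι → ℕ => ∑ k, n k) hn))
  have hgeom : ∑ i ∈ Finset.range K, x ^ i ≤ (1 - x)⁻¹ := by
    rw [← tsum_geometric_of_lt_one hx (by linarith)]
    exact (summable_geometric_of_lt_one hx (by linarith)).sum_le_tsum _
      fun i _ => pow_nonneg hx i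
  have hbern : 1 / 2 ≤ (1 - x) ^ Fintype.card ι := by
    have := one_add_mul_le_pow (a := -x) (by linarith) (Fintype.card ι)
    rw [← sub_eq_add_neg] at this
    linarith
  calc ∑ n ∈ s, x ^ (∑ k, n k)
      ≤ ∑ n ∈ Fintype.piFinset fun _ : ι => Finset.range K, x ^ (∑ k, n k) :=
        Finset.sum_le_sum_of_subset_of_nonneg hsub fun _ _ _ => pow_nonneg hx _
    _ = (∑ i ∈ Finset.range K, x ^ i) ^ Fintype.card ι := by
        simp_rw [← Finset.prod_pow_eq_pow_sum]
        rw [← Finset.prod_univ_sum (fun _ : ι => Finset.range K) (fun _ i => x ^ i)]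
        simp
    _ ≤ ((1 - x)⁻¹) ^ Fintype.card ι :=
        pow_le_pow_left₀ (Finset.sum_nonneg fun _ _ => pow_nonneg hx _) hgeom _
    _ ≤ 2 := by
        rw [inv_pow]
        exact inv_le_of_inv_le₀ (by norm_num) (by linarith)

/-- **A quantitative `ℓ² ≥ ℓ¹`-type estimate for geometric weights.**
Let `N ∈ ℕ` and let `ε` be a real number with `0 < ε ≤ 1/√(2(N+1))`. Then for every finitely
supported family `(bₙ)` of nonnegative reals indexed by multi-indices `n ∈ ℕ^{N+1}`,
`Σₙ bₙ² ≥ (1/2)·(Σₙ bₙ·ε^{|n|})²` where `|n|` is the sum of the coordinates of `n`. -/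
theorem sum_sq_ge_half_sq_sum_geometric (N : ℕ) (ε : ℝ) (hε : 0 < ε)
    (hε' : ε ≤ 1 / Real.sqrt (2 * (N + 1)))
    (b : (Fin (N + 1) → ℕ) → ℝ) (hb : ∀ n, 0 ≤ b n)
    (hsupp : (Function.support b).Finite) :
    (1 / 2) * (∑ᶠ n : Fin (N + 1) → ℕ, b n * ε ^ (∑ k, n k)) ^ 2
      ≤ ∑ᶠ n : Fin (N + 1) → ℕ, (b n) ^ 2 := by
  have hsq : (N + 1) * ε ^ 2 ≤ 1 / 2 := by
    have h := pow_le_pow_left₀ hε.le hε' 2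
    rw [div_pow, Real.sq_sqrt (by positivity), one_pow, le_div_iff₀ (by positivity)] at h
    linarith
  rw [finsum_eq_sum_of_support_subset (s := hsupp.toFinset) _ (by
      intro n hn
      simp only [Function.mem_support] at hn
      simpa using left_ne_zero_of_mul hn),
    finsum_eq_sum_of_support_subset (s := hsupp.toFinset) _ (by
      intro n hn
      simpa using hn)]
  have hgeom : ∑ n ∈ hsupp.toFinset, (ε ^ (∑ k, n k)) ^ 2 ≤ 2 := by
    simp_rw [pow_right_comm ε _ 2]
    exact sum_pow_sum_le_two (sq_nonneg ε) (by simpa using hsq) _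
  have hcs := Finset.sum_mul_sq_le_sq_mul_sq hsupp.toFinset b fun n => ε ^ (∑ k, n k)
  have hnonneg : 0 ≤ ∑ n ∈ hsupp.toFinset, b n ^ 2 := Finset.sum_nonneg fun n _ => sq_nonneg _
  have := mul_le_mul_of_nonneg_left hgeom hnonneg
  linarith
end
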